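/- (Lemma 4, inequality (13a).) Assume 0 ≤ p01 ≤ p11 ≤ 1 and β ∈ (0,1]. For every 1 ≤ n ≤ T and every v = (v_1, …, v_N) ∈ [0,1]^N, the pseudo value function of the batteryless model satisfies 1 + W_n(v_N, v_1, v_2, …, v_{N−1}) ≥ W_n(v_1, …, v_N), where the left-hand argument is the cyclic shift of v placing the last coordinate first. -/

import Mathlib

/-- The set of scheduled indices `{1,…,K}` (the first `K` coordinates). -/
def sched (N K : ℕ) : Finset (Fin N) := Finset.univ.filter (fun i => i.val < K)

/-- Sort the entries of a vector in decreasing order. -/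
noncomputable def sortVec (N : ℕ) (v : Fin N → ℝ) : Fin N → ℝ :=
  fun i => ((List.ofFn v).mergeSort (fun a b => decide (b ≤ a))).getD i.val 0

/-- The next belief vector `[P11(Σl), τ(v_Ē), P01(|E|-Σl)]` of the batteryless model:
`|H|` entries `p11` (the active coordinates `H ⊆ E` found harvesting), then
`τ(x) = (p11 - p01)·x + p01` applied entrywise to the coordinates of `v` outside the active
set `E` (kept in their original order), then `|E| - |H|` entries `p01`. -/
noncomputable def nextVec2 (N : ℕ) (p01 p11 : ℝ) (E H : Finset (Fin N)) (v : Fin N → ℝ) :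
    Fin N → ℝ :=
  fun i => (List.replicate H.card p11 ++
      ((Finset.univ \ E).sort (· ≤ ·)).map (fun j => (p11 - p01) * v j + p01) ++
      List.replicate (E.card - H.card) p01).getD i.val 0

/-- The pseudo value function of the batteryless model, indexed by remaining time:
`W2 … m v` is the pseudo value function `W_n(v)` of the paper with `m = T - n` slots
remaining after the current one; `W2 … 0 v = p·Σ_{i=1}^K v_i` and
`W2 … (m+1) v = p·Σ_{i=1}^K v_i + β·Σ_{E ⊆ {1,…,K}} Σ_{H ⊆ E}
  (1-p)^(K-|E|) p^|E| (Π_{j∈H} v_j)(Π_{j∈E∖H}(1-v_j)) · W2 … m ([P11(|H|), τ(v_Ē), P01(|E|-|H|)])`. -/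
noncomputable def W2 (N K : ℕ) (β p p01 p11 : ℝ) : ℕ → (Fin N → ℝ) → ℝ
  | 0, v => p * ∑ i ∈ sched N K, v i
  | m + 1, v => p * ∑ i ∈ sched N K, v i +
      β * ∑ E ∈ (sched N K).powerset, ∑ H ∈ E.powerset,
        ((1 - p) ^ (K - E.card) * p ^ E.card * (∏ j ∈ H, v j) * (∏ j ∈ E \ H, (1 - v j))) *
          W2 N K β p p01 p11 m (nextVec2 N p01 p11 E H v)

/-- The belief update `τ` of an unobserved coordinate. -/
def beliefStep (p01 p11 x : ℝ) : ℝ := (p11 - p01) * x + p01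

/-- Expectation of `f a l b` when each coordinate of a list is independently active with
probability `p`: `a` active coordinates are found harvesting, `b` are not, and `l` lists the
updated beliefs of the inactive ones. -/
noncomputable def obsExp (p p01 p11 : ℝ) : List ℝ → (ℕ → List ℝ → ℕ → ℝ) → ℝ
  | [], f => f 0 [] 0
  | x :: s, f =>
      (1 - p) * obsExp p p01 p11 s (fun a l b => f a (beliefStep p01 p11 x :: l) b) +
      p * (x * obsExp p p01 p11 s (fun a l b => f (a + 1) l b) +
        (1 - x) * obsExp p p01 p11 s (fun a l b => f a l (b + 1)))

/-- The belief list after `a` good and `b` bad observations. -/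
def nextList (p01 p11 : ℝ) (a : ℕ) (l d : List ℝ) (b : ℕ) : List ℝ :=
  List.replicate a p11 ++ (l ++ (d ++ List.replicate b p01))

/-- The pseudo value function on lists of beliefs. -/
noncomputable def listValue (K : ℕ) (β p p01 p11 : ℝ) : ℕ → List ℝ → ℝ
  | 0, v => p * (v.take K).sum
  | m + 1, v => p * (v.take K).sum + β * obsExp p p01 p11 (v.take K) (fun a l b =>
      listValue K β p p01 p11 m
        (nextList p01 p11 a l ((v.drop K).map (beliefStep p01 p11)) b))

section ListValue

variable {K : ℕ} {β p p01 p11 : ℝ}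

lemma beliefStep_affine (t x y : ℝ) :
    beliefStep p01 p11 (t * x + (1 - t) * y) =
      t * beliefStep p01 p11 x + (1 - t) * beliefStep p01 p11 y := by
  unfold beliefStep; ring

lemma beliefStep_eq (x : ℝ) : beliefStep p01 p11 x = x * p11 + (1 - x) * p01 := by
  unfold beliefStep; ring

lemma beliefStep_mono (h : p01 ≤ p11) {x y : ℝ} (hxy : x ≤ y) :
    beliefStep p01 p11 x ≤ beliefStep p01 p11 y := by
  unfold beliefStep; nlinarith

lemma beliefStep_mem (h : p01 ≤ p11) {x : ℝ}
    (hx : x ∈ Set.Icc (0 : ℝ) 1) : beliefStep p01 p11 x ∈ Set.Icc p01 p11 := by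
  obtain ⟨hx0, hx1⟩ := hx
  unfold beliefStep
  constructor <;> nlinarith

lemma obsExp_affine (t : ℝ) (s : List ℝ) (f g : ℕ → List ℝ → ℕ → ℝ) :
    obsExp p p01 p11 s (fun a l b => t * f a l b + (1 - t) * g a l b) =
      t * obsExp p p01 p11 s f + (1 - t) * obsExp p p01 p11 s g := by
  induction s generalizing f g with
  | nil => rfl
  | cons x s ih =>
    simp only [obsExp]
    rw [ih, ih, ih]
    ring

lemma obsExp_add_const (c : ℝ) (s : List ℝ) (f : ℕ → List ℝ → ℕ → ℝ) :
    obsExp p p01 p11 s (fun a l b => f a l b + c) = obsExp p p01 p11 s f + c := by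
  induction s generalizing f with
  | nil => rfl
  | cons x s ih =>
    simp only [obsExp]
    rw [ih, ih, ih]
    ring

lemma obsExp_append_singleton (s : List ℝ) (y : ℝ) (f : ℕ → List ℝ → ℕ → ℝ) :
    obsExp p p01 p11 (s ++ [y]) f = obsExp p p01 p11 s (fun a l b =>
      (1 - p) * f a (l ++ [beliefStep p01 p11 y]) b +
        p * (y * f (a + 1) l b + (1 - y) * f a l (b + 1))) := by
  induction s generalizing f with
  | nil => rfl
  | cons x s ih =>
    simp only [List.cons_append, obsExp]
    rw [ih, ih, ih]

lemma obsExp_congr (s : List ℝ) (f g : ℕ → List ℝ → ℕ → ℝ)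
    (h : ∀ a l b, a + l.length + b = s.length → f a l b = g a l b) :
    obsExp p p01 p11 s f = obsExp p p01 p11 s g := by
  induction s generalizing f g with
  | nil => exact h 0 [] 0 rfl
  | cons x s ih =>
    simp only [obsExp]
    rw [ih (fun a l b => f a (beliefStep p01 p11 x :: l) b)
        (fun a l b => g a (beliefStep p01 p11 x :: l) b),
      ih (fun a l b => f (a + 1) l b) (fun a l b => g (a + 1) l b),
      ih (fun a l b => f a l (b + 1)) (fun a l b => g a l (b + 1))]
    all_goals
      intro a l b hab
      apply h
      simp only [List.length_cons]
      omega

lemma obsExp_mono (hp0 : 0 ≤ p) (hp1 : p ≤ 1) (h : p01 ≤ p11)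
    (s : List ℝ) (hs : ∀ x ∈ s, x ∈ Set.Icc (0 : ℝ) 1) (f g : ℕ → List ℝ → ℕ → ℝ)
    (hfg : ∀ a l b, a + l.length + b = s.length → (∀ x ∈ l, x ∈ Set.Icc p01 p11) →
      f a l b ≤ g a l b) :
    obsExp p p01 p11 s f ≤ obsExp p p01 p11 s g := by
  induction s generalizing f g with
  | nil => exact hfg 0 [] 0 rfl (by simp)
  | cons x s ih =>
    have hx := hs x (by simp)
    have hs' : ∀ x ∈ s, x ∈ Set.Icc (0 : ℝ) 1 := fun y hy => hs y (by simp [hy])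
    have hx0 : 0 ≤ x := hx.1
    have hx1 : 0 ≤ 1 - x := sub_nonneg.2 hx.2
    have hp1' : 0 ≤ 1 - p := sub_nonneg.2 hp1
    simp only [obsExp]
    gcongr
    · refine ih hs' _ _ fun a l b hab hl => hfg _ _ _ ?_ ?_
      · simp only [List.length_cons]; omega
      · simpa using ⟨beliefStep_mem h hx, hl⟩
    · refine ih hs' _ _ fun a l b hab hl => hfg _ _ _ ?_ hl
      simp only [List.length_cons]; omega
    · refine ih hs' _ _ fun a l b hab hl => hfg _ _ _ ?_ hl
      simp only [List.length_cons]; omega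

lemma obsExp_perm {s s' : List ℝ} (hs : s.Perm s') (f : ℕ → List ℝ → ℕ → ℝ)
    (hf : ∀ a l l' b, a + l.length + b = s.length → l.Perm l' → f a l b = f a l' b) :
    obsExp p p01 p11 s f = obsExp p p01 p11 s' f := by
  induction hs generalizing f with
  | nil => rfl
  | cons x hs ih =>
    simp only [obsExp]
    rw [ih (fun a l b => f a (beliefStep p01 p11 x :: l) b), ih (fun a l b => f (a + 1) l b),
      ih (fun a l b => f a l (b + 1))]
    · intro a l l' b hab hl
      exact hf _ _ _ _ (by simp only [List.length_cons]; omega) hl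
    · intro a l l' b hab hl
      exact hf _ _ _ _ (by simp only [List.length_cons]; omega) hl
    · intro a l l' b hab hl
      exact hf _ _ _ _ (by simp only [List.length_cons]; omega) (hl.cons _)
  | swap x y s =>
    simp only [obsExp]
    rw [obsExp_congr s (fun a l b => f a (beliefStep p01 p11 y :: beliefStep p01 p11 x :: l) b)
      (fun a l b => f a (beliefStep p01 p11 x :: beliefStep p01 p11 y :: l) b)]
    · ring
    · intro a l b hab
      exact hf _ _ _ _ (by simp only [List.length_cons]; omega) (List.Perm.swap _ _ _)
  | trans h₁ h₂ ih₁ ih₂ =>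
    rw [ih₁ f hf, ih₂ f]
    intro a l l' b hab hl
    exact hf _ _ _ _ (by rw [h₁.length_eq]; exact hab) hl

lemma drop_append_eq_of_perm {s s' : List ℝ} (r : List ℝ) (hs : s.Perm s')
    (hK : s.length ≤ K) : (s ++ r).drop K = (s' ++ r).drop K := by
  rw [List.drop_append (l₁ := s), List.drop_append (l₁ := s'), List.drop_eq_nil_of_le hK,
    List.drop_eq_nil_of_le (as := s') (hs.length_eq ▸ hK), hs.length_eq]

lemma take_append_perm_of_perm {s s' : List ℝ} (r : List ℝ) (hs : s.Perm s')
    (hK : s.length ≤ K) : ((s ++ r).take K).Perm ((s' ++ r).take K) := by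
  rw [List.take_append (l₁ := s), List.take_append (l₁ := s'), List.take_of_length_le hK,
    List.take_of_length_le (l := s') (hs.length_eq ▸ hK), hs.length_eq]
  exact hs.append_right _

/-- The value does not depend on the order of the scheduled coordinates. -/
lemma listValue_perm (m : ℕ) {s s' : List ℝ} (r : List ℝ) (hs : s.Perm s') (hK : s.length ≤ K) :
    listValue K β p p01 p11 m (s ++ r) = listValue K β p p01 p11 m (s' ++ r) := by
  have hdrop := drop_append_eq_of_perm r hs hK
  have htake := take_append_perm_of_perm r hs hK
  induction m generalizing s s' r with
  | zero => simp only [listValue, htake.sum_eq]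
  | succ m ih =>
    simp only [listValue, htake.sum_eq, hdrop]
    congr 2
    refine obsExp_perm htake _ fun a l l' b hab hl => ?_
    have hk : (List.replicate a p11 ++ l).length ≤ K := by
      have := List.length_take_le K (s ++ r)
      simp only [List.length_append, List.length_replicate]
      omega
    have hpm := hl.append_left (List.replicate a p11)
    simp only [nextList]
    rw [← List.append_assoc, ← List.append_assoc (List.replicate a p11)]
    exact ih _ hpm hk (drop_append_eq_of_perm _ hpm hk) (take_append_perm_of_perm _ hpm hk)

lemma listValue_affine (m : ℕ) (P Q : List ℝ) (t x y : ℝ) :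
    listValue K β p p01 p11 m (P ++ (t * x + (1 - t) * y) :: Q) =
      t * listValue K β p p01 p11 m (P ++ x :: Q) +
        (1 - t) * listValue K β p p01 p11 m (P ++ y :: Q) := by
  induction m generalizing P Q x y with
  | zero =>
    simp only [listValue, List.take_append, List.sum_append]
    rcases K - P.length with _ | k
    · simp; ring
    · simp; ring
  | succ m ih =>
    rcases lt_or_ge P.length K with hP | hP
    · have hmove : ∀ z : ℝ, listValue K β p p01 p11 (m + 1) (P ++ z :: Q) =
          listValue K β p p01 p11 (m + 1) (z :: (P ++ Q)) := by
        intro z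
        have := listValue_perm (K := K) (β := β) (p := p) (p01 := p01) (p11 := p11) (m + 1)
          (s := P ++ [z]) (s' := z :: P) Q
          (List.perm_append_singleton z P) (by simpa using hP)
        simpa using this
      obtain ⟨k, rfl⟩ : ∃ k, K = k + 1 := ⟨K - 1, by omega⟩
      have hlin : ∀ z : ℝ → ℝ, ∀ (s d : List ℝ),
          z (t * x + (1 - t) * y) = t * z x + (1 - t) * z y →
          obsExp p p01 p11 s (fun a l b => listValue (k + 1) β p p01 p11 m
            (nextList p01 p11 a (z (t * x + (1 - t) * y) :: l) d b)) =
          t * obsExp p p01 p11 s (fun a l b => listValue (k + 1) β p p01 p11 m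
            (nextList p01 p11 a (z x :: l) d b)) +
          (1 - t) * obsExp p p01 p11 s (fun a l b => listValue (k + 1) β p p01 p11 m
            (nextList p01 p11 a (z y :: l) d b)) := by
        intro z s d hz
        rw [hz, ← obsExp_affine]
        refine obsExp_congr _ _ _ fun a l b _ => ?_
        simp only [nextList, List.cons_append]
        exact ih _ _ _ _
      rw [hmove, hmove, hmove]
      simp only [listValue, List.take_succ_cons, List.drop_succ_cons, obsExp, List.sum_cons]
      rw [hlin (beliefStep p01 p11) _ _ (beliefStep_affine t x y)]
      ring
    · simp only [listValue, List.take_append_of_le_length hP, List.drop_append_of_le_length hP,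
        List.map_append, List.map_cons, beliefStep_affine]
      have : obsExp p p01 p11 (P.take K) (fun a l b => listValue K β p p01 p11 m
            (nextList p01 p11 a l ((P.drop K).map (beliefStep p01 p11) ++
              (t * beliefStep p01 p11 x + (1 - t) * beliefStep p01 p11 y) ::
                Q.map (beliefStep p01 p11)) b)) =
          obsExp p p01 p11 (P.take K) (fun a l b =>
            t * listValue K β p p01 p11 m
              (nextList p01 p11 a l ((P.drop K).map (beliefStep p01 p11) ++
                beliefStep p01 p11 x :: Q.map (beliefStep p01 p11)) b) +
            (1 - t) * listValue K β p p01 p11 m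
              (nextList p01 p11 a l ((P.drop K).map (beliefStep p01 p11) ++
                beliefStep p01 p11 y :: Q.map (beliefStep p01 p11)) b)) := by
        refine obsExp_congr _ _ _ fun a l b _ => ?_
        have := ih (List.replicate a p11 ++ (l ++ (P.drop K).map (beliefStep p01 p11)))
          (Q.map (beliefStep p01 p11) ++ List.replicate b p01)
          (beliefStep p01 p11 x) (beliefStep p01 p11 y)
        simpa [nextList] using this
      rw [this, obsExp_affine]
      ring

lemma listValue_beliefStep (m : ℕ) (P Q : List ℝ) (x : ℝ) :
    listValue K β p p01 p11 m (P ++ beliefStep p01 p11 x :: Q) =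
      x * listValue K β p p01 p11 m (P ++ p11 :: Q) +
        (1 - x) * listValue K β p p01 p11 m (P ++ p01 :: Q) := by
  rw [beliefStep_eq, listValue_affine]

/-- A function on belief lists that does not decrease when an adjacent pair is put in
decreasing order. -/
def AdjacentSwapMono (F : List ℝ → ℝ) : Prop :=
  ∀ (P Q : List ℝ) (x y : ℝ), (∀ z ∈ P ++ x :: y :: Q, z ∈ Set.Icc (0 : ℝ) 1) → y ≤ x →
    F (P ++ y :: x :: Q) ≤ F (P ++ x :: y :: Q)

/-- A function on belief lists that loses at most `1` under a cyclic shift. -/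
def CyclicShiftBound (F : List ℝ → ℝ) : Prop :=
  ∀ (l : List ℝ) (z : ℝ), (∀ x ∈ z :: l, x ∈ Set.Icc (0 : ℝ) 1) → F (l ++ [z]) ≤ 1 + F (z :: l)

lemma AdjacentSwapMono.move_left {F : List ℝ → ℝ} (hF : AdjacentSwapMono F) (P R Q : List ℝ)
    (x : ℝ) (h : ∀ z ∈ P ++ x :: (R ++ Q), z ∈ Set.Icc (0 : ℝ) 1) (hx : ∀ z ∈ R, z ≤ x) :
    F (P ++ (R ++ x :: Q)) ≤ F (P ++ x :: (R ++ Q)) := by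
  induction R generalizing P with
  | nil => simp
  | cons r R ih =>
    have h₁ := ih (P ++ [r]) (fun z hz => h z (by simp at hz ⊢; tauto))
      (fun z hz => hx z (by simp [hz]))
    have h₂ := hF P (R ++ Q) x r (by simpa using h) (hx r (by simp))
    simp only [List.append_assoc, List.cons_append, List.nil_append] at h₁ h₂ ⊢
    exact h₁.trans h₂

lemma AdjacentSwapMono.move_right {F : List ℝ → ℝ} (hF : AdjacentSwapMono F) (P R Q : List ℝ)
    (x : ℝ) (h : ∀ z ∈ P ++ x :: (R ++ Q), z ∈ Set.Icc (0 : ℝ) 1) (hx : ∀ z ∈ R, x ≤ z) :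
    F (P ++ x :: (R ++ Q)) ≤ F (P ++ (R ++ x :: Q)) := by
  induction R generalizing P with
  | nil => simp
  | cons r R ih =>
    have h₁ := ih (P ++ [r]) (fun z hz => h z (by simp at hz ⊢; tauto))
      (fun z hz => hx z (by simp [hz]))
    have h₂ := hF P (R ++ Q) r x (fun z hz => h z (by simp at hz ⊢; tauto)) (hx r (by simp))
    simp only [List.append_assoc, List.cons_append, List.nil_append] at h₁ h₂ ⊢
    exact h₂.trans h₁

/-- Moving one coordinate to an earlier position costs at most `1`. -/
lemma listValue_move_left_le (m : ℕ) (hS : AdjacentSwapMono (listValue K β p p01 p11 m))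
    (hC : CyclicShiftBound (listValue K β p p01 p11 m)) (P R Q : List ℝ) (x : ℝ)
    (h : ∀ z ∈ P ++ x :: (R ++ Q), z ∈ Set.Icc (0 : ℝ) 1) :
    listValue K β p p01 p11 m (P ++ (R ++ x :: Q)) ≤
      1 + listValue K β p p01 p11 m (P ++ x :: (R ++ Q)) := by
  have hPRQ : ∀ z ∈ P ++ (R ++ Q), z ∈ Set.Icc (0 : ℝ) 1 :=
    fun z hz => h z (by simp at hz ⊢; tauto)
  have hins : ∀ t ∈ Set.Icc (0 : ℝ) 1, ∀ z ∈ P ++ t :: (R ++ Q), z ∈ Set.Icc (0 : ℝ) 1 := by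
    intro t ht z hz
    have := hPRQ z
    simp only [List.mem_append, List.mem_cons] at hz this
    rcases hz with hz | rfl | hz
    · exact this (Or.inl hz)
    · exact ht
    · exact this (Or.inr hz)
  have hx := h x (by simp)
  have one := hS.move_left P R Q 1 (hins 1 (by simp))
    (fun z hz => (hPRQ z (by simp [hz])).2)
  have hzero : ∀ z ∈ 0 :: (P ++ (R ++ Q)), z ∈ Set.Icc (0 : ℝ) 1 := by
    intro z hz
    rcases List.mem_cons.1 hz with rfl | hz
    · simp
    · exact hPRQ z hz
  have zero₁ := hS.move_right (P ++ R) Q [] 0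
    (fun z hz => hzero z (by simp at hz ⊢; tauto)) (fun z hz => (hPRQ z (by simp [hz])).1)
  have zero₂ := hC (P ++ (R ++ Q)) 0 hzero
  have zero₃ := hS.move_right [] P (R ++ Q) 0 (by simpa using hzero)
    (fun z hz => (hPRQ z (by simp [hz])).1)
  simp only [List.append_assoc, List.nil_append, List.append_nil] at zero₁ zero₂ zero₃
  have aff : ∀ A B : List ℝ, listValue K β p p01 p11 m (A ++ x :: B) =
      x * listValue K β p p01 p11 m (A ++ 1 :: B) +
        (1 - x) * listValue K β p p01 p11 m (A ++ 0 :: B) := by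
    intro A B
    rw [← listValue_affine]
    simp
  have e := aff (P ++ R) Q
  simp only [List.append_assoc] at e
  rw [e, aff P (R ++ Q)]
  have hx0 := hx.1
  have hx1 := hx.2
  nlinarith [mul_le_mul_of_nonneg_left one hx0,
    mul_le_mul_of_nonneg_left (zero₁.trans (zero₂.trans (add_le_add_right zero₃ 1)))
      (sub_nonneg.2 hx1)]

lemma listValue_succ_scheduled (m : ℕ) (S Q : List ℝ) (y : ℝ) (hS : S.length + 1 = K) :
    listValue K β p p01 p11 (m + 1) (S ++ y :: Q) =
      p * (S.sum + y) + β * obsExp p p01 p11 S (fun a l b =>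
        (1 - p) * listValue K β p p01 p11 m (nextList p01 p11 a (l ++ [beliefStep p01 p11 y])
            (Q.map (beliefStep p01 p11)) b) +
        p * (y * listValue K β p p01 p11 m
              (nextList p01 p11 (a + 1) l (Q.map (beliefStep p01 p11)) b) +
          (1 - y) * listValue K β p p01 p11 m
              (nextList p01 p11 a l (Q.map (beliefStep p01 p11)) (b + 1)))) := by
  have e : S ++ y :: Q = (S ++ [y]) ++ Q := by simp
  have hl : (S ++ [y]).length = K := by simpa using hS
  simp only [listValue, e, List.take_left' hl, List.drop_left' hl, obsExp_append_singleton]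
  simp

lemma replicate_append_cons_perm (a : ℕ) (x : ℝ) (l : List ℝ) :
    (List.replicate (a + 1) x ++ l).Perm (List.replicate a x ++ (l ++ [x])) := by
  rw [List.replicate_succ, ← List.append_assoc]
  exact (List.perm_append_singleton x _).symm

lemma nextList_mem (h0 : 0 ≤ p01) (h : p01 ≤ p11) (h1 : p11 ≤ 1) (a b : ℕ) (l d : List ℝ)
    (hl : ∀ x ∈ l, x ∈ Set.Icc (0 : ℝ) 1) (hd : ∀ x ∈ d, x ∈ Set.Icc (0 : ℝ) 1) :
    ∀ x ∈ nextList p01 p11 a l d b, x ∈ Set.Icc (0 : ℝ) 1 := by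
  intro x hx
  simp only [nextList, List.mem_append, List.mem_replicate] at hx
  rcases hx with ⟨-, rfl⟩ | hx | hx | ⟨-, rfl⟩
  · exact ⟨h0.trans h, h1⟩
  · exact hl x hx
  · exact hd x hx
  · exact ⟨h0, h.trans h1⟩

lemma map_beliefStep_mem (h0 : 0 ≤ p01) (h : p01 ≤ p11) (h1 : p11 ≤ 1) {d : List ℝ}
    (hd : ∀ x ∈ d, x ∈ Set.Icc (0 : ℝ) 1) :
    ∀ x ∈ d.map (beliefStep p01 p11), x ∈ Set.Icc (0 : ℝ) 1 := by
  intro x hx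
  obtain ⟨y, hy, rfl⟩ := List.mem_map.1 hx
  exact Set.Icc_subset_Icc h0 h1 (beliefStep_mem h (hd y hy))

lemma listValue_succ_adjacentSwapMono (hβ0 : 0 ≤ β) (hβ1 : β ≤ 1) (hp0 : 0 ≤ p) (hp1 : p ≤ 1)
    (h0 : 0 ≤ p01) (h : p01 ≤ p11) (h1 : p11 ≤ 1) (m : ℕ)
    (hS : AdjacentSwapMono (listValue K β p p01 p11 m))
    (hC : CyclicShiftBound (listValue K β p p01 p11 m)) :
    AdjacentSwapMono (listValue K β p p01 p11 (m + 1)) := by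
  intro P Q x y hmem hyx
  have hP : ∀ z ∈ P, z ∈ Set.Icc (0 : ℝ) 1 := fun z hz => hmem z (by simp [hz])
  have hQ : ∀ z ∈ Q, z ∈ Set.Icc (0 : ℝ) 1 := fun z hz => hmem z (by simp [hz])
  have hx := hmem x (by simp)
  have hy := hmem y (by simp)
  have hτQ := map_beliefStep_mem h0 h h1 hQ
  have hsub := Set.Icc_subset_Icc h0 h1
  have hτx := hsub (beliefStep_mem h hx)
  have hτy := hsub (beliefStep_mem h hy)
  rcases le_or_gt (P.length + 2) K with hK | hK
  · refine le_of_eq ?_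
    have := listValue_perm (K := K) (β := β) (p := p) (p01 := p01) (p11 := p11) (m + 1)
      (s := P ++ [y, x]) (s' := P ++ [x, y]) Q
      ((List.Perm.swap x y []).append_left P) (by simpa using hK)
    simpa using this
  rcases le_or_gt K P.length with hK' | hK'
  · simp only [listValue, List.take_append_of_le_length hK', List.drop_append_of_le_length hK',
      List.map_append, List.map_cons]
    gcongr
    refine obsExp_mono hp0 hp1 h _ (fun z hz => hP z (List.mem_of_mem_take hz)) _ _
      fun a l b _ hl => ?_
    have hl' : ∀ z ∈ l, z ∈ Set.Icc (0 : ℝ) 1 := fun z hz => hsub (hl z hz)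
    have hd := map_beliefStep_mem h0 h h1 (d := P.drop K ++ x :: y :: Q)
      (fun z hz => hmem z (by
        simp only [List.mem_append, List.mem_cons] at hz ⊢
        exact hz.imp_left List.mem_of_mem_drop))
    have := hS (List.replicate a p11 ++ (l ++ (P.drop K).map (beliefStep p01 p11)))
      (Q.map (beliefStep p01 p11) ++ List.replicate b p01)
      (beliefStep p01 p11 x) (beliefStep p01 p11 y)
      (by simpa [nextList] using nextList_mem h0 h h1 a b l _ hl' hd)
      (beliefStep_mono h hyx)
    simpa [nextList] using this
  · have hlen : P.length + 1 = K := by omega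
    rw [listValue_succ_scheduled m P (x :: Q) y hlen, listValue_succ_scheduled m P (y :: Q) x hlen]
    set V := listValue K β p p01 p11 m with hV
    have key := obsExp_mono hp0 hp1 h P hP
      (fun a l b =>
        (1 - p) * V (nextList p01 p11 a (l ++ [beliefStep p01 p11 y])
            ((x :: Q).map (beliefStep p01 p11)) b) +
        p * (y * V (nextList p01 p11 (a + 1) l ((x :: Q).map (beliefStep p01 p11)) b) +
          (1 - y) * V (nextList p01 p11 a l ((x :: Q).map (beliefStep p01 p11)) (b + 1))))
      (fun a l b =>
        ((1 - p) * V (nextList p01 p11 a (l ++ [beliefStep p01 p11 x])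
            ((y :: Q).map (beliefStep p01 p11)) b) +
        p * (x * V (nextList p01 p11 (a + 1) l ((y :: Q).map (beliefStep p01 p11)) b) +
          (1 - x) * V (nextList p01 p11 a l ((y :: Q).map (beliefStep p01 p11)) (b + 1)))) +
        p * (x - y))
      (fun a l b hab hl => by
        have hl' : ∀ z ∈ l, z ∈ Set.Icc (0 : ℝ) 1 := fun z hz => hsub (hl z hz)
        have inactive := hS (List.replicate a p11 ++ l)
          (Q.map (beliefStep p01 p11) ++ List.replicate b p01)
          (beliefStep p01 p11 x) (beliefStep p01 p11 y)
          (by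
            have hd : ∀ z ∈ beliefStep p01 p11 x :: beliefStep p01 p11 y ::
                Q.map (beliefStep p01 p11), z ∈ Set.Icc (0 : ℝ) 1 := by
              simpa only [List.forall_mem_cons] using ⟨hτx, hτy, hτQ⟩
            simpa [nextList] using nextList_mem h0 h h1 a b l _ hl' hd)
          (beliefStep_mono h hyx)
        have active : V (List.replicate a p11 ++ (l ++ p11 ::
              (Q.map (beliefStep p01 p11) ++ List.replicate (b + 1) p01))) ≤
            1 + V (List.replicate (a + 1) p11 ++ (l ++ p01 ::
              (Q.map (beliefStep p01 p11) ++ List.replicate b p01))) := by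
          have hm := listValue_move_left_le m hS hC (List.replicate (a + 1) p11 ++ l)
            (Q.map (beliefStep p01 p11) ++ List.replicate b p01) [] p01
            (by
              have hd : ∀ z ∈ p01 :: Q.map (beliefStep p01 p11), z ∈ Set.Icc (0 : ℝ) 1 := by
                simpa only [List.forall_mem_cons] using ⟨⟨h0, h.trans h1⟩, hτQ⟩
              simpa [nextList] using nextList_mem h0 h h1 (a + 1) b l _ hl' hd)
          have hp := listValue_perm (K := K) (β := β) (p := p) (p01 := p01) (p11 := p11) m
            (Q.map (beliefStep p01 p11) ++ List.replicate (b + 1) p01)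
            (replicate_append_cons_perm a p11 l)
            (by simp only [List.length_append, List.length_replicate]; omega)
          rw [List.replicate_succ' (n := b)] at hp ⊢
          simp only [List.append_assoc, List.append_nil, List.cons_append,
            List.nil_append] at hm hp ⊢
          rw [hV, ← hp]
          exact hm
        have e := fun A B x => listValue_beliefStep (K := K) (β := β) (p := p) (p01 := p01)
          (p11 := p11) m A B x
        rw [← hV] at e
        have e₁ := e (List.replicate (a + 1) p11 ++ l)
          (Q.map (beliefStep p01 p11) ++ List.replicate b p01)
        have e₂ := e (List.replicate a p11 ++ l)
          (Q.map (beliefStep p01 p11) ++ List.replicate (b + 1) p01)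
        simp only [nextList, List.map_cons, List.append_assoc, List.cons_append,
          List.nil_append] at inactive e₁ e₂ ⊢
        rw [e₁ x, e₁ y, e₂ x, e₂ y]
        have hp1' : 0 ≤ 1 - p := sub_nonneg.2 hp1
        have hxy : 0 ≤ p * (x - y) := mul_nonneg hp0 (sub_nonneg.2 hyx)
        linarith [mul_le_mul_of_nonneg_left inactive hp1', mul_le_mul_of_nonneg_left active hxy])
    rw [obsExp_add_const (c := p * (x - y))] at key
    have hxy : 0 ≤ p * (x - y) := mul_nonneg hp0 (sub_nonneg.2 hyx)
    linarith [mul_le_mul_of_nonneg_left key hβ0, mul_le_mul_of_nonneg_right hβ1 hxy]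

lemma listValue_succ_cyclicShiftBound (hK : 1 ≤ K) (hβ0 : 0 ≤ β) (hβ1 : β ≤ 1) (hp0 : 0 ≤ p)
    (hp1 : p ≤ 1) (h0 : 0 ≤ p01) (h : p01 ≤ p11) (h1 : p11 ≤ 1) (m : ℕ)
    (hS : AdjacentSwapMono (listValue K β p p01 p11 m))
    (hC : CyclicShiftBound (listValue K β p p01 p11 m)) :
    CyclicShiftBound (listValue K β p p01 p11 (m + 1)) := by
  intro r z hmem
  rcases lt_or_ge r.length K with hr | hr
  · have := listValue_perm (K := K) (β := β) (p := p) (p01 := p01) (p11 := p11) (m + 1)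
      [] (List.perm_append_singleton z r) (by simpa using hr)
    simp only [List.append_nil] at this
    rw [this]
    linarith
  obtain ⟨P, y, Q, hlen, rfl⟩ : ∃ P y Q, P.length + 1 = K ∧ r = P ++ y :: Q := by
    refine ⟨r.take (K - 1), r[K - 1]'(by omega), r.drop (K - 1 + 1), ?_, ?_⟩
    · rw [List.length_take]; omega
    · rw [← List.drop_eq_getElem_cons, List.take_append_drop]
  have hP : ∀ w ∈ P, w ∈ Set.Icc (0 : ℝ) 1 := fun w hw => hmem w (by simp [hw])
  have hQ : ∀ w ∈ Q, w ∈ Set.Icc (0 : ℝ) 1 := fun w hw => hmem w (by simp [hw])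
  have hz := hmem z (by simp)
  have hy := hmem y (by simp)
  have hτQ := map_beliefStep_mem h0 h h1 hQ
  have hsub := Set.Icc_subset_Icc h0 h1
  have hτz := hsub (beliefStep_mem h hz)
  have hτy := hsub (beliefStep_mem h hy)
  have h01 : p01 ∈ Set.Icc (0 : ℝ) 1 := ⟨h0, h.trans h1⟩
  have h11 : p11 ∈ Set.Icc (0 : ℝ) 1 := ⟨h0.trans h, h1⟩
  have hfront := listValue_perm (K := K) (β := β) (p := p) (p01 := p01) (p11 := p11) (m + 1)
      (y :: Q) (List.perm_append_singleton z P).symm (by simpa using hlen.le)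
  simp only [List.cons_append, List.append_assoc, List.nil_append] at hfront ⊢
  rw [hfront, listValue_succ_scheduled m P (Q ++ [z]) y hlen,
    listValue_succ_scheduled m P (y :: Q) z hlen]
  set V := listValue K β p p01 p11 m with hV
  have key := obsExp_mono hp0 hp1 h P hP
    (fun a l b =>
      (1 - p) * V (nextList p01 p11 a (l ++ [beliefStep p01 p11 y])
          ((Q ++ [z]).map (beliefStep p01 p11)) b) +
      p * (y * V (nextList p01 p11 (a + 1) l ((Q ++ [z]).map (beliefStep p01 p11)) b) +
        (1 - y) * V (nextList p01 p11 a l ((Q ++ [z]).map (beliefStep p01 p11)) (b + 1))))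
    (fun a l b =>
      ((1 - p) * V (nextList p01 p11 a (l ++ [beliefStep p01 p11 z])
          ((y :: Q).map (beliefStep p01 p11)) b) +
      p * (z * V (nextList p01 p11 (a + 1) l ((y :: Q).map (beliefStep p01 p11)) b) +
        (1 - z) * V (nextList p01 p11 a l ((y :: Q).map (beliefStep p01 p11)) (b + 1)))) +
      (1 + p * (z - y)))
    (fun a l b hab hl => by
      have hl' : ∀ w ∈ l, w ∈ Set.Icc (0 : ℝ) 1 := fun w hw => hsub (hl w hw)
      have hins : ∀ t ∈ Set.Icc (0 : ℝ) 1, ∀ i j,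
          ∀ w ∈ nextList p01 p11 i l (t :: Q.map (beliefStep p01 p11)) j,
            w ∈ Set.Icc (0 : ℝ) 1 := fun t ht i j =>
        nextList_mem h0 h h1 i j l _ hl' (by
          simpa only [List.forall_mem_cons] using ⟨ht, hτQ⟩)
      have move := fun A R B x hx => listValue_move_left_le m hS hC A R B x hx
      rw [← hV] at move
      have inactive := move (List.replicate a p11 ++ l)
        (beliefStep p01 p11 y :: Q.map (beliefStep p01 p11))
        (List.replicate b p01) (beliefStep p01 p11 z)
        (by
          have hd : ∀ w ∈ beliefStep p01 p11 z :: beliefStep p01 p11 y ::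
              Q.map (beliefStep p01 p11), w ∈ Set.Icc (0 : ℝ) 1 := by
            simpa only [List.forall_mem_cons] using ⟨hτz, hτy, hτQ⟩
          simpa [nextList] using nextList_mem h0 h h1 a b l _ hl' hd)
      have good_good := move (List.replicate (a + 1) p11 ++ l) (Q.map (beliefStep p01 p11))
        (List.replicate b p01) p11 (by simpa [nextList] using hins p11 h11 (a + 1) b)
      have bad_bad := move (List.replicate a p11 ++ l) (Q.map (beliefStep p01 p11))
        (List.replicate (b + 1) p01) p01 (by simpa [nextList] using hins p01 h01 a (b + 1))
      have good_bad : V (List.replicate (a + 1) p11 ++ (l ++ (Q.map (beliefStep p01 p11) ++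
            p01 :: List.replicate b p01))) =
          V (List.replicate a p11 ++ (l ++ p11 :: (Q.map (beliefStep p01 p11) ++
            List.replicate (b + 1) p01))) := by
        have hp := listValue_perm (K := K) (β := β) (p := p) (p01 := p01) (p11 := p11) m
          (Q.map (beliefStep p01 p11) ++ List.replicate (b + 1) p01)
          (replicate_append_cons_perm a p11 l)
          (by simp only [List.length_append, List.length_replicate]; omega)
        simpa [List.replicate_succ] using hp
      have bad_good : V (List.replicate a p11 ++ (l ++ (Q.map (beliefStep p01 p11) ++
            p11 :: List.replicate (b + 1) p01))) ≤
          2 + V (List.replicate (a + 1) p11 ++ (l ++ p01 :: (Q.map (beliefStep p01 p11) ++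
            List.replicate b p01))) := by
        have m₁ := move (List.replicate a p11) (l ++ Q.map (beliefStep p01 p11))
          (List.replicate (b + 1) p01) p11
          (by
            have := nextList_mem h0 h h1 (a + 1) (b + 1) l _ hl' hτQ
            simpa [nextList, List.replicate_succ', or_imp, forall_and] using this)
        have m₂ := move (List.replicate (a + 1) p11 ++ l)
          (Q.map (beliefStep p01 p11) ++ List.replicate b p01) [] p01
          (by simpa [nextList] using hins p01 h01 (a + 1) b)
        simp only [List.replicate_succ', List.append_assoc, List.append_nil, List.cons_append,
          List.nil_append] at m₁ m₂ ⊢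
        linarith
      have e := fun A B x => listValue_beliefStep (K := K) (β := β) (p := p) (p01 := p01)
        (p11 := p11) m A B x
      rw [← hV] at e
      have e₁ := e (List.replicate (a + 1) p11 ++ (l ++ Q.map (beliefStep p01 p11)))
        (List.replicate b p01) z
      have e₂ := e (List.replicate a p11 ++ (l ++ Q.map (beliefStep p01 p11)))
        (List.replicate (b + 1) p01) z
      have e₃ := e (List.replicate (a + 1) p11 ++ l)
        (Q.map (beliefStep p01 p11) ++ List.replicate b p01) y
      have e₄ := e (List.replicate a p11 ++ l)
        (Q.map (beliefStep p01 p11) ++ List.replicate (b + 1) p01) y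
      simp only [nextList, List.map_append, List.map_cons, List.map_nil, List.append_assoc,
        List.cons_append, List.nil_append] at inactive good_good bad_bad e₁ e₂ e₃ e₄ ⊢
      rw [e₁, e₂, e₃, e₄, good_bad]
      have hp1' : 0 ≤ 1 - p := sub_nonneg.2 hp1
      have hz' : 0 ≤ 1 - z := sub_nonneg.2 hz.2
      have hy' : 0 ≤ 1 - y := sub_nonneg.2 hy.2
      linarith [mul_le_mul_of_nonneg_left inactive hp1',
        mul_le_mul_of_nonneg_left good_good (mul_nonneg hp0 (mul_nonneg hy.1 hz.1)),
        mul_le_mul_of_nonneg_left bad_good (mul_nonneg hp0 (mul_nonneg hy' hz.1)),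
        mul_le_mul_of_nonneg_left bad_bad (mul_nonneg hp0 (mul_nonneg hy' hz'))])
  rw [obsExp_add_const (c := 1 + p * (z - y))] at key
  have hc : 0 ≤ 1 + p * (z - y) := by
    nlinarith [mul_nonneg hp0 hz.1, mul_nonneg hp0 (sub_nonneg.2 hy.2)]
  linarith [mul_le_mul_of_nonneg_left key hβ0, mul_le_mul_of_nonneg_right hβ1 hc]

lemma listValue_zero_adjacentSwapMono (hp0 : 0 ≤ p) :
    AdjacentSwapMono (listValue K β p p01 p11 0) := by
  intro P Q x y _ hyx
  simp only [listValue, List.take_append, List.sum_append]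
  gcongr p * (_ + ?_)
  rcases K - P.length with _ | _ | k
  · simp
  · simpa using hyx
  · simp only [List.take_succ_cons, List.sum_cons]
    linarith

lemma listValue_zero_cyclicShiftBound (hK : 1 ≤ K) (hp0 : 0 ≤ p) (hp1 : p ≤ 1) :
    CyclicShiftBound (listValue K β p p01 p11 0) := by
  intro l z hmem
  obtain ⟨k, rfl⟩ : ∃ k, K = k + 1 := ⟨K - 1, by omega⟩
  have hz := hmem z (by simp)
  have hsum : ((l ++ [z]).take (k + 1)).sum ≤ 1 + (z + (l.take k).sum) := by
    rcases lt_or_ge k l.length with hk | hk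
    · rw [List.take_append_of_le_length hk, List.sum_take_succ _ _ hk]
      linarith [hz.1, (hmem l[k] (by simp)).2]
    · rw [List.take_of_length_le (by simpa using hk), List.take_of_length_le hk]
      simp only [List.sum_append, List.sum_singleton]
      linarith
  simp only [listValue, List.take_succ_cons, List.sum_cons]
  nlinarith

lemma listValue_swap_and_shift (hK : 1 ≤ K) (hβ0 : 0 ≤ β) (hβ1 : β ≤ 1) (hp0 : 0 ≤ p)
    (hp1 : p ≤ 1) (h0 : 0 ≤ p01) (h : p01 ≤ p11) (h1 : p11 ≤ 1) (m : ℕ) :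
    AdjacentSwapMono (listValue K β p p01 p11 m) ∧
      CyclicShiftBound (listValue K β p p01 p11 m) := by
  induction m with
  | zero => exact ⟨listValue_zero_adjacentSwapMono hp0, listValue_zero_cyclicShiftBound hK hp0 hp1⟩
  | succ m ih =>
    exact ⟨listValue_succ_adjacentSwapMono hβ0 hβ1 hp0 hp1 h0 h h1 m ih.1 ih.2,
      listValue_succ_cyclicShiftBound hK hβ0 hβ1 hp0 hp1 h0 h h1 m ih.1 ih.2⟩

end ListValue

section Transfer

variable {N K : ℕ} {β p p01 p11 : ℝ}

lemma sum_powerset_eq_obsExp {ι : Type*} [DecidableEq ι] (v : ι → ℝ) (s : List ι)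
    (hs : s.Nodup) (f : ℕ → List ℝ → ℕ → ℝ) :
    ∑ E ∈ s.toFinset.powerset, ∑ H ∈ E.powerset,
      ((1 - p) ^ (s.length - E.card) * p ^ E.card * (∏ j ∈ H, v j) * (∏ j ∈ E \ H, (1 - v j))) *
        f H.card ((s.filter (· ∉ E)).map fun j => beliefStep p01 p11 (v j)) (E.card - H.card) =
      obsExp p p01 p11 (s.map v) f := by
  induction s generalizing f with
  | nil => simp [obsExp]
  | cons x s ih =>
    obtain ⟨hx, hs'⟩ := List.nodup_cons.1 hs
    have hxs : x ∉ s.toFinset := by simpa using hx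
    simp only [List.map_cons, obsExp]
    rw [← ih hs', ← ih hs', ← ih hs', List.toFinset_cons, Finset.sum_powerset_insert hxs,
      mul_add p]
    simp only [Finset.mul_sum]
    congr 1
    · refine Finset.sum_congr rfl fun E hE => Finset.sum_congr rfl fun H _ => ?_
      have hEs := Finset.mem_powerset.1 hE
      have hxE : x ∉ E := fun hxE => hxs (hEs hxE)
      have hcard : E.card ≤ s.length := (Finset.card_le_card hEs).trans s.toFinset_card_le
      rw [List.filter_cons_of_pos (by simpa using hxE), List.map_cons, List.length_cons,
        Nat.succ_sub hcard, pow_succ]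
      ring
    · rw [← Finset.sum_add_distrib]
      refine Finset.sum_congr rfl fun E hE => ?_
      have hEs := Finset.mem_powerset.1 hE
      have hxE : x ∉ E := fun hxE => hxs (hEs hxE)
      have hfilter : (x :: s).filter (· ∉ insert x E) = s.filter (· ∉ E) := by
        rw [List.filter_cons_of_neg (by simp)]
        refine List.filter_congr fun y hy => ?_
        have : y ≠ x := fun h => hx (h ▸ hy)
        simp [this]
      rw [Finset.sum_powerset_insert hxE, add_comm, hfilter, Finset.card_insert_of_notMem hxE]
      congr 1
      · refine Finset.sum_congr rfl fun H hH => ?_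
        have hxH : x ∉ H := fun hxH => hxE (Finset.mem_powerset.1 hH hxH)
        rw [Finset.card_insert_of_notMem hxH, Finset.prod_insert hxH,
          Finset.insert_sdiff_insert, Finset.sdiff_insert_of_notMem hxE, List.length_cons,
          Nat.add_sub_add_right, Nat.add_sub_add_right, pow_succ]
        ring
      · refine Finset.sum_congr rfl fun H hH => ?_
        have hHE := Finset.mem_powerset.1 hH
        have hxH : x ∉ H := fun hxH => hxE (hHE hxH)
        rw [Finset.insert_sdiff_of_notMem _ hxH, Finset.prod_insert (by simp [hxE]),
          List.length_cons, Nat.add_sub_add_right, Nat.succ_sub (Finset.card_le_card hHE),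
          pow_succ]
        ring

lemma toFinset_take_finRange : ((List.finRange N).take K).toFinset = sched N K := by
  ext i
  simp only [List.mem_toFinset, List.mem_take_iff_getElem, sched, Finset.mem_filter,
    Finset.mem_univ, true_and, List.getElem_finRange]
  constructor
  · rintro ⟨j, hj, rfl⟩
    simp at hj ⊢
    omega
  · intro hi
    exact ⟨i, by simpa using hi, by simp⟩

lemma sort_univ_sdiff (E : Finset (Fin N)) :
    (Finset.univ \ E).sort (· ≤ ·) = (List.finRange N).filter (· ∉ E) := by
  have hnd : ((List.finRange N).filter (· ∉ E)).Nodup := (List.nodup_finRange N).filter _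
  have hset : Finset.univ \ E = ((List.finRange N).filter (· ∉ E)).toFinset := by
    ext i
    simp
  rw [hset, List.toFinset_sort (· ≤ ·) hnd]
  exact ((List.pairwise_lt_finRange N).imp le_of_lt).filter _

lemma ofFn_nextVec2 {E H : Finset (Fin N)} (hE : E ⊆ sched N K) (hH : H ⊆ E) (v : Fin N → ℝ) :
    List.ofFn (nextVec2 N p01 p11 E H v) =
      nextList p01 p11 H.card
        ((((List.finRange N).take K).filter (· ∉ E)).map fun j => beliefStep p01 p11 (v j))
        (((List.ofFn v).drop K).map (beliefStep p01 p11)) (E.card - H.card) := by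
  have hlist : nextList p01 p11 H.card
        ((((List.finRange N).take K).filter (· ∉ E)).map fun j => beliefStep p01 p11 (v j))
        (((List.ofFn v).drop K).map (beliefStep p01 p11)) (E.card - H.card) =
      List.replicate H.card p11 ++
        ((Finset.univ \ E).sort (· ≤ ·)).map (fun j => (p11 - p01) * v j + p01) ++
        List.replicate (E.card - H.card) p01 := by
    have hdrop : ((List.finRange N).drop K).filter (· ∉ E) = (List.finRange N).drop K := by
      refine List.filter_eq_self.2 fun i hi => ?_
      have hnd := List.nodup_finRange N
      rw [← List.take_append_drop K (List.finRange N)] at hnd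
      have hdisj := List.disjoint_of_nodup_append hnd
      have : i ∉ E := fun hiE => hdisj
        (List.mem_toFinset.1 (toFinset_take_finRange (N := N) (K := K) ▸ hE hiE)) hi
      simpa using this
    have hsplit : (List.finRange N).filter (· ∉ E) =
        ((List.finRange N).take K).filter (· ∉ E) ++ (List.finRange N).drop K := by
      conv_lhs => rw [← List.take_append_drop K (List.finRange N), List.filter_append, hdrop]
    rw [sort_univ_sdiff, hsplit, List.map_append, List.ofFn_eq_map, ← List.map_drop, List.map_map]
    simp only [nextList, List.append_assoc]
    rfl
  rw [hlist]
  have hcard := Finset.card_le_card hH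
  have hN : E.card ≤ N := by simpa using E.card_le_univ
  refine List.ext_getElem ?_ fun i hi hi' => ?_
  · simp [Finset.card_sdiff]
    omega
  · rw [List.getElem_ofFn, nextVec2, List.getD_eq_getElem _ _ hi']

lemma W2_eq_listValue (hKN : K ≤ N) (m : ℕ) (v : Fin N → ℝ) :
    W2 N K β p p01 p11 m v = listValue K β p p01 p11 m (List.ofFn v) := by
  have hnd : ((List.finRange N).take K).Nodup := (List.nodup_finRange N).take
  have htake : (List.ofFn v).take K = ((List.finRange N).take K).map v := by
    rw [List.ofFn_eq_map, List.map_take]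
  have hsum : ∑ i ∈ sched N K, v i = ((List.ofFn v).take K).sum := by
    rw [htake, ← toFinset_take_finRange, List.sum_toFinset _ hnd]
  induction m generalizing v with
  | zero => simp only [W2, listValue, hsum]
  | succ m ih =>
    have hlen : ((List.finRange N).take K).length = K := by simpa using hKN
    simp only [W2, listValue, hsum]
    rw [htake, ← sum_powerset_eq_obsExp v _ hnd, toFinset_take_finRange, hlen]
    congr 2
    refine Finset.sum_congr rfl fun E hE => Finset.sum_congr rfl fun H hH => ?_
    rw [← ofFn_nextVec2 (Finset.mem_powerset.1 hE) (Finset.mem_powerset.1 hH), ih]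
    · rw [List.ofFn_eq_map, List.map_take]
    · rw [List.ofFn_eq_map, ← List.map_take, ← toFinset_take_finRange, List.sum_toFinset _ hnd]

end Transfer

/-- Lemma 4, inequality (13a): for the batteryless pseudo value function,
`1 + W_n(v_N, v_1, …, v_{N-1}) ≥ W_n(v_1, …, v_N)`, where the left-hand argument is the
cyclic shift of `v` placing the last coordinate first. -/
theorem batteryless_cyclic_shift_bound
    (N K T : ℕ) (hK : 1 ≤ K) (hKN : K ≤ N) (hT : 1 ≤ T)
    (β p p01 p11 : ℝ) (hβ0 : 0 < β) (hβ1 : β ≤ 1) (hp0 : 0 ≤ p) (hp1 : p ≤ 1)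
    (hp010 : 0 ≤ p01) (hp0111 : p01 ≤ p11) (hp111 : p11 ≤ 1)
    (n : ℕ) (hn1 : 1 ≤ n) (hnT : n ≤ T)
    (v : Fin N → ℝ) (hv : ∀ i, v i ∈ Set.Icc (0 : ℝ) 1) :
    W2 N K β p p01 p11 (T - n) v ≤
      1 + W2 N K β p p01 p11 (T - n)
        (fun i : Fin N =>
          if _h : i.val = 0 then v ⟨N - 1, by omega⟩ else v ⟨i.val - 1, by omega⟩) := by
  obtain ⟨M, rfl⟩ : ∃ M, N = M + 1 := ⟨N - 1, by omega⟩
  rw [W2_eq_listValue hKN, W2_eq_listValue hKN]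
  have hC := (listValue_swap_and_shift hK hβ0.le hβ1 hp0 hp1 hp010 hp0111 hp111 (T - n)).2
  have h := hC (List.ofFn fun i : Fin M => v i.castSucc) (v (Fin.last M)) (by
    intro x hx
    rcases List.mem_cons.1 hx with rfl | hx
    · exact hv _
    · obtain ⟨i, rfl⟩ := (List.mem_ofFn' _ _).1 hx
      exact hv _)
  have hl : List.ofFn v = (List.ofFn fun i : Fin M => v i.castSucc) ++ [v (Fin.last M)] := by
    rw [List.ofFn_succ']
    simp [List.concat_eq_append]
  rw [hl]
  refine h.trans_eq ?_
  rw [List.ofFn_succ]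
  simp only [Fin.val_zero, Fin.val_succ]
  rfl
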